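/- Let n ≥ 4, let 2 ≤ p ≤ n−2, and let λ_1,…,λ_n be reals with λ_1 ≥ ⋯ ≥ λ_p > 0 > λ_{p+1} ≥ ⋯ ≥ λ_n, with each λ_i ∉ ℤ_{≥0} and λ := λ_1+⋯+λ_n ∉ ℤ_{≥0}. With d defined as below: d(0) = 1, and for every k ≥ 1 one has |d(k)| < C(k+n−2, n−2). Equivalently, the only definite multiplicity space in M_{λ_1} ⊗ ⋯ ⊗ M_{λ_n} is the level-0 space, which is positive definite. -/

import Mathlib

open scoped Classical

/-- `fsig λ k` is the coefficient of `e^{λ-2k}` in the signature character of the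
Verma module `M_λ` evaluated at `s = -1`. -/
noncomputable def fsig (lam : ℝ) (k : ℤ) : ℤ :=
  if k < 0 then 0
  else if lam < 0 then (-1) ^ k.toNat
  else if k ≤ ⌊lam⌋ then 1
  else (-1) ^ (k + ⌈lam⌉).toNat

/-- `convSig n lam k = Σ_{k₁+⋯+k_n = k} ∏_i f_{λ_i}(k_i)`, the coefficient of
`e^{λ−2k}` in the product of signature characters at `s = −1`. -/
noncomputable def convSig (n : ℕ) (lam : Fin n → ℝ) (k : ℕ) : ℤ :=
  ∑ x ∈ Finset.Nat.antidiagonalTuple n k, ∏ i, fsig (lam i) (x i)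

/-- `fsig` as a function of `N = ⌈λ⌉`, with every sign written through a residue mod 2. -/
def vermaSign (N k : ℤ) : ℤ :=
  if k < 0 then 0 else 1 - 2 * (max (k - max N 0) 0 % 2)

/-- The sign of the level-`m` singular vector in a product of two Verma modules, where `A`, `B`, `C`
are the ceilings of the two highest weights and of their sum. It is the sign of
`∏ i < m, (a - i) * (b - i) * (a + b - m + 1 - i)`. -/
def pairSign (A B C m : ℤ) : ℤ :=
  if m < 0 then 0 else
    1 - 2 * ((max (m - max A 0) 0 + max (m - max B 0) 0 + m - max (min (C - m + 1) m) 0) % 2)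

theorem pairSign_eq (A B C m a b c : ℤ) (h : 0 ≤ m) (ha : max (m - max A 0) 0 = a)
    (hb : max (m - max B 0) 0 = b) (hc : max (min (C - m + 1) m) 0 = c) :
    pairSign A B C m = 1 - 2 * ((a + b + m - c) % 2) := by
  rw [pairSign, if_neg (by omega), ha, hb, hc]

set_option maxHeartbeats 4000000 in
/-- Coefficient at `x ^ K` of `(1 - x²) F_A F_B = (1 - x²) ∑ m, pairSign A B C m * x ^ m * F_{C - 2m}`,
where `F_N` is the generating series of `vermaSign N`. -/
theorem vermaSign_convolution_coeff (A B C K : ℤ) (hC : C = A + B ∨ C = A + B - 1) (hK : 0 ≤ K) :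
    vermaSign B K + vermaSign B (K - 1) - 2 * vermaSign B (K - max A 0 - 1) =
      pairSign A B C K + pairSign A B C (K - 1) -
        2 * ((if C ≤ 2 * K - 2 then pairSign A B C (K - 1) else 0) +
          if C < 2 * K - 2 ∧ K ≤ C + 1 then pairSign A B C (C + 1 - K) else 0) := by
  obtain rfl | hK1 : K = 0 ∨ 1 ≤ K := by omega
  · simp only [vermaSign, pairSign]; split_ifs <;> omega
  have hA : ∃ a, max A 0 = a ∧ (A ≤ 0 ∧ a = 0 ∨ 0 < A ∧ a = A) := ⟨_, rfl, by omega⟩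
  have hB : ∃ b, max B 0 = b ∧ (B ≤ 0 ∧ b = 0 ∨ 0 < B ∧ b = B) := ⟨_, rfl, by omega⟩
  have hK : ∃ u, max (K - max A 0) 0 = u ∧
      (K ≤ max A 0 ∧ u = 0 ∨ max A 0 < K ∧ u = K - max A 0) := ⟨_, rfl, by omega⟩
  have hL : ∃ v, max (K - max B 0) 0 = v ∧
      (K ≤ max B 0 ∧ v = 0 ∨ max B 0 < K ∧ v = K - max B 0) := ⟨_, rfl, by omega⟩
  have hM : ∃ w, max (min (C - K + 1) K) 0 = w ∧
      (2 * K ≤ C + 1 ∧ w = K ∨ C + 1 < 2 * K ∧ K ≤ C + 1 ∧ w = C - K + 1 ∨ C + 1 < K ∧ w = 0) :=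
    ⟨_, rfl, by omega⟩
  have hM' : ∃ w', max (min (C - (K - 1) + 1) (K - 1)) 0 = w' ∧
      (2 * (K - 1) ≤ C + 1 ∧ w' = K - 1 ∨
        C + 1 < 2 * (K - 1) ∧ K - 1 ≤ C + 1 ∧ w' = C - K + 2 ∨ C + 1 < K - 1 ∧ w' = 0) :=
    ⟨_, rfl, by omega⟩
  obtain ⟨a, ha, hA⟩ := hA
  obtain ⟨b, hb, hB⟩ := hB
  rw [ha] at hK ⊢
  rw [hb] at hL
  obtain ⟨u, hu, hK⟩ := hK
  obtain ⟨v, hv, hL⟩ := hL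
  obtain ⟨w, hw, hM⟩ := hM
  obtain ⟨w', hw', hM'⟩ := hM'
  have hK' : ∃ u', max (K - 1 - a) 0 = u' ∧ (K ≤ a ∧ u' = 0 ∨ a < K ∧ u' = K - 1 - a) :=
    ⟨_, rfl, by omega⟩
  have hL' : ∃ v', max (K - 1 - b) 0 = v' ∧ (K ≤ b ∧ v' = 0 ∨ b < K ∧ v' = K - 1 - b) :=
    ⟨_, rfl, by omega⟩
  obtain ⟨u', hu', hK'⟩ := hK'
  obtain ⟨v', hv', hL'⟩ := hL'
  have e1 : pairSign A B C K = 1 - 2 * ((u + v + K - w) % 2) :=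
    pairSign_eq _ _ _ _ _ _ _ (by omega) (by rw [ha, hu]) (by rw [hb, hv]) hw
  have e2 : pairSign A B C (K - 1) = 1 - 2 * ((u' + v' + (K - 1) - w') % 2) :=
    pairSign_eq _ _ _ _ _ _ _ (by omega) (by rw [ha, hu']) (by rw [hb, hv']) hw'
  have e3 : ∃ s, (if C < 2 * K - 2 ∧ K ≤ C + 1 then pairSign A B C (C + 1 - K) else 0) = s ∧
      ((C < 2 * K - 2 ∧ K ≤ C + 1) ∧ (∃ x y : ℤ, s = 1 - 2 * ((x + y) % 2) ∧
          (C + 1 - K ≤ a ∧ x = 0 ∨ a < C + 1 - K ∧ x = C + 1 - K - a) ∧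
          (C + 1 - K ≤ b ∧ y = 0 ∨ b < C + 1 - K ∧ y = C + 1 - K - b)) ∨
        (2 * K - 2 ≤ C ∨ C + 1 < K) ∧ s = 0) := by
    refine ⟨_, rfl, ?_⟩
    by_cases h : C < 2 * K - 2 ∧ K ≤ C + 1
    · rw [if_pos h, pairSign_eq A B C (C + 1 - K) _ _ (C + 1 - K) (by omega) rfl rfl (by omega),
        ha, hb]
      exact Or.inl ⟨h, max (C + 1 - K - a) 0, max (C + 1 - K - b) 0, by rw [add_sub_cancel_right], by omega,
        by omega⟩
    · rw [if_neg h]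
      exact Or.inr ⟨by omega, rfl⟩
  have p1 : vermaSign B K = 1 - 2 * (v % 2) := by rw [vermaSign, if_neg (by omega), hb, hv]
  have p2 : vermaSign B (K - 1) = 1 - 2 * (v' % 2) := by
    rw [vermaSign, if_neg (by omega), hb, hv']
  have p3 : ∃ r, vermaSign B (K - a - 1) = r ∧ (K ≤ a ∧ r = 0 ∨
      a < K ∧ K - a - 1 ≤ b ∧ r = 1 ∨
      a < K ∧ b < K - a - 1 ∧ r = 1 - 2 * ((K - a - 1 - b) % 2)) := by
    refine ⟨_, rfl, ?_⟩
    rw [vermaSign, hb]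
    split_ifs
    · omega
    · rcases le_total (K - a - 1) b with h | h
      · rw [max_eq_right (by omega)]; omega
      · rw [max_eq_left (by omega)]; omega
  obtain ⟨s, hs, e3⟩ := e3
  obtain ⟨r, hr, p3⟩ := p3
  rw [hs, hr, e1, e2, p1, p2]
  clear hs hr e1 e2 p1 p2 hv' hu' hw hw' hu hv ha hb
  rcases hA with ⟨hA, rfl⟩ | ⟨hA, rfl⟩ <;> rcases hB with ⟨hB, rfl⟩ | ⟨hB, rfl⟩
  all_goals
    rcases hK with ⟨hK, rfl⟩ | ⟨hK, rfl⟩ <;> rcases hK' with ⟨hK', rfl⟩ | ⟨hK', rfl⟩ <;>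
      first | (exfalso; clear * - hK hK'; omega) | skip
  all_goals
    rcases hL with ⟨hL, rfl⟩ | ⟨hL, rfl⟩ <;> rcases hL' with ⟨hL', rfl⟩ | ⟨hL', rfl⟩ <;>
      first | (exfalso; clear * - hL hL'; omega) | skip
  all_goals
    rcases e3 with ⟨h3, x, y, rfl, ⟨hx, rfl⟩ | ⟨hx, rfl⟩, ⟨hy, rfl⟩ | ⟨hy, rfl⟩⟩ | ⟨h3, rfl⟩ <;>
      rcases p3 with ⟨hp, rfl⟩ | ⟨hp, hp', rfl⟩ | ⟨hp, hp', rfl⟩ <;>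
      first | (exfalso; clear hM hM'; omega) | skip
  all_goals
    rcases hM with ⟨hM, rfl⟩ | ⟨hM, hM2, rfl⟩ | ⟨hM, rfl⟩ <;>
      rcases hM' with ⟨hM', rfl⟩ | ⟨hM', hM2', rfl⟩ | ⟨hM', rfl⟩ <;>
      first | (exfalso; omega) | skip
  all_goals
    split_ifs with h <;> first | (exfalso; omega) | skip
  all_goals
    first
    | omega
    | rcases Int.even_or_odd' K with ⟨c, rfl | rfl⟩ <;> omega

theorem neg_one_pow_toNat (k : ℤ) (hk : 0 ≤ k) : (-1 : ℤ) ^ k.toNat = 1 - 2 * (k % 2) := by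
  obtain ⟨n, rfl⟩ := Int.eq_ofNat_of_zero_le hk
  rcases Nat.even_or_odd' n with ⟨c, rfl | rfl⟩
  · rw [Int.toNat_natCast, pow_mul]; simp
  · rw [Int.toNat_natCast, pow_succ, pow_mul]; push_cast; simp [Int.add_emod]

theorem fsig_eq_vermaSign (μ : ℝ) (k : ℤ) : fsig μ k = vermaSign ⌈μ⌉ k := by
  unfold fsig vermaSign
  by_cases hk : k < 0
  · simp [hk]
  rw [if_neg hk, if_neg hk]
  have h1 : ⌈μ⌉ ≤ ⌊μ⌋ + 1 := Int.ceil_le_floor_add_one μ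
  have h2 : ⌊μ⌋ ≤ ⌈μ⌉ := Int.floor_le_ceil μ
  by_cases hμ : μ < 0
  · have : ⌈μ⌉ ≤ 0 := Int.ceil_le.2 (by simpa using hμ.le)
    rw [if_pos hμ, neg_one_pow_toNat k (by omega)]
    omega
  · have h0 : 0 ≤ ⌊μ⌋ := Int.floor_nonneg.2 (not_lt.1 hμ)
    rw [if_neg hμ]
    by_cases hk' : k ≤ ⌊μ⌋
    · rw [if_pos hk']; omega
    · rw [if_neg hk', neg_one_pow_toNat _ (by omega)]
      omega

theorem vermaSign_of_neg (N k : ℤ) (h : k < 0) : vermaSign N k = 0 := if_pos h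

theorem pairSign_of_neg (A B C m : ℤ) (h : m < 0) : pairSign A B C m = 0 := if_pos h

theorem abs_pairSign_le (A B C m : ℤ) : |pairSign A B C m| ≤ 1 := by
  unfold pairSign
  rw [abs_le]
  split_ifs <;> omega

theorem vermaSign_sub (N j : ℤ) : vermaSign N j - vermaSign N (j - 2) =
    (if j = 0 then 1 else 0) + (if j = 1 then 1 else 0) -
      2 * if j = max N 0 + 1 then 1 else 0 := by
  unfold vermaSign
  split_ifs <;> omega

theorem sum_range_ite_cast_eq (u : ℤ → ℤ) (hu : ∀ z < 0, u z = 0) (K : ℕ) (z : ℤ) (hz : z ≤ K) :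
    ∑ m ∈ Finset.range (K + 1), (if (m : ℤ) = z then u m else 0) = u z := by
  rcases lt_or_ge z 0 with h | h
  · rw [hu z h]
    exact Finset.sum_eq_zero fun m _ => if_neg (by omega)
  · lift z to ℕ using h
    rw [Finset.sum_eq_single z]
    · simp
    · intro m _ hm; exact if_neg (by omega)
    · intro hm; simp at hm; omega

theorem sum_vermaSign_sub (u : ℤ → ℤ) (hu : ∀ z < 0, u z = 0) (N : ℕ → ℤ) (K : ℕ) :
    ∑ m ∈ Finset.range (K + 1),
        u m * (vermaSign (N m) (K - m) - vermaSign (N m) (K - m - 2)) =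
      u K + u (K - 1) -
        2 * ∑ m ∈ Finset.range (K + 1), if (K : ℤ) - m = max (N m) 0 + 1 then u m else 0 := by
  rw [← sum_range_ite_cast_eq u hu K K le_rfl, ← sum_range_ite_cast_eq u hu K (K - 1) (by omega),
    Finset.mul_sum, ← Finset.sum_add_distrib, ← Finset.sum_sub_distrib]
  refine Finset.sum_congr rfl fun m _ => ?_
  rw [vermaSign_sub, mul_sub, mul_add]
  simp only [mul_ite, mul_one, mul_zero]
  congr 1
  · congr 1 <;> exact if_congr (by omega) rfl rfl
  · split_ifs <;> ring

theorem sum_vermaSign_step (u : ℤ → ℤ) (N : ℕ → ℤ) (K : ℕ) :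
    ∑ m ∈ Finset.range (K + 2 + 1), u m * vermaSign (N m) ((K + 2 : ℕ) - m) =
      ∑ m ∈ Finset.range (K + 2 + 1),
        u m * (vermaSign (N m) ((K + 2 : ℕ) - m) - vermaSign (N m) ((K + 2 : ℕ) - m - 2)) +
      ∑ m ∈ Finset.range (K + 1), u m * vermaSign (N m) (K - m) := by
  have h : ∑ m ∈ Finset.range (K + 1), u m * vermaSign (N m) (K - m) =
      ∑ m ∈ Finset.range (K + 2 + 1), u m * vermaSign (N m) ((K + 2 : ℕ) - m - 2) := by
    rw [Finset.sum_range_succ _ (K + 2), Finset.sum_range_succ _ (K + 1),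
      vermaSign_of_neg _ _ (by push_cast; omega), vermaSign_of_neg _ _ (by push_cast; omega)]
    simp only [mul_zero, add_zero]
    refine Finset.sum_congr rfl fun m _ => ?_
    congr 2; push_cast; ring
  rw [h, ← Finset.sum_add_distrib]
  exact Finset.sum_congr rfl fun m _ => by ring

theorem sum_vermaSign_sub_eq (A B C : ℤ) (hC : C = A + B ∨ C = A + B - 1) (K : ℕ) :
    ∑ m ∈ Finset.range (K + 1),
        vermaSign B m * (vermaSign A (K - m) - vermaSign A (K - m - 2)) =
      ∑ m ∈ Finset.range (K + 1),
        pairSign A B C m * (vermaSign (C - 2 * m) (K - m) - vermaSign (C - 2 * m) (K - m - 2)) := by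
  rw [sum_vermaSign_sub (vermaSign B) (fun _ => vermaSign_of_neg _ _) (fun _ => A),
    sum_vermaSign_sub (pairSign A B C) (fun _ => pairSign_of_neg _ _ _ _) (fun m => C - 2 * m)]
  have hL : ∑ m ∈ Finset.range (K + 1),
      (if (K : ℤ) - m = max A 0 + 1 then vermaSign B m else 0) =
        vermaSign B (K - max A 0 - 1) := by
    rw [← sum_range_ite_cast_eq (vermaSign B) (fun _ => vermaSign_of_neg _ _) K _ (by omega)]
    exact Finset.sum_congr rfl fun m _ => if_congr (by omega) rfl rfl
  have hR : ∑ m ∈ Finset.range (K + 1),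
      (if (K : ℤ) - m = max (C - 2 * m) 0 + 1 then pairSign A B C m else 0) =
        (if C ≤ 2 * (K : ℤ) - 2 then pairSign A B C (K - 1) else 0) +
          if C < 2 * (K : ℤ) - 2 ∧ (K : ℤ) ≤ C + 1 then pairSign A B C (C + 1 - K) else 0 := by
    have e1 := sum_range_ite_cast_eq (pairSign A B C) (fun _ => pairSign_of_neg _ _ _ _) K (K - 1)
      (by omega)
    have e2 (h : C < 2 * (K : ℤ) - 2 ∧ (K : ℤ) ≤ C + 1) :=
      sum_range_ite_cast_eq (pairSign A B C) (fun _ => pairSign_of_neg _ _ _ _) K (C + 1 - K)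
        (by omega)
    split_ifs with h1 h2 h2
    · rw [← e1, ← e2 h2, ← Finset.sum_add_distrib]
      refine Finset.sum_congr rfl fun m _ => ?_
      split_ifs <;> omega
    · rw [← e1, add_zero]
      exact Finset.sum_congr rfl fun m _ => if_congr (by omega) rfl rfl
    · omega
    · exact Finset.sum_eq_zero fun m _ => if_neg (by omega)
  rw [hL, hR]
  exact vermaSign_convolution_coeff A B C K hC (by omega)

theorem sum_vermaSign_mul (A B C : ℤ) (hC : C = A + B ∨ C = A + B - 1) (K : ℕ) :
    ∑ m ∈ Finset.range (K + 1), vermaSign B m * vermaSign A (K - m) =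
      ∑ m ∈ Finset.range (K + 1), pairSign A B C m * vermaSign (C - 2 * m) (K - m) := by
  have small (u : ℤ → ℤ) (N : ℕ → ℤ) (K : ℕ) (hK : K < 2) :
      ∑ m ∈ Finset.range (K + 1), u m * vermaSign (N m) (K - m) =
        ∑ m ∈ Finset.range (K + 1),
          u m * (vermaSign (N m) (K - m) - vermaSign (N m) (K - m - 2)) :=
    Finset.sum_congr rfl fun m _ => by
      rw [vermaSign_of_neg _ ((K : ℤ) - m - 2) (by omega), sub_zero]
  induction K using Nat.strong_induction_on with
  | _ K ih =>
    rcases lt_or_ge K 2 with h | h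
    · rw [small (vermaSign B) (fun _ => A) K h, small (pairSign A B C) (fun m => C - 2 * m) K h]
      exact sum_vermaSign_sub_eq A B C hC K
    · obtain ⟨J, rfl⟩ := Nat.exists_eq_add_of_le' h
      rw [sum_vermaSign_step (vermaSign B) (fun _ => A),
        sum_vermaSign_step (pairSign A B C) (fun m => C - 2 * m), ih J (by omega),
        sum_vermaSign_sub_eq A B C hC]

/-- The signature character of the Verma module of highest weight `μ`, as a power series. -/
noncomputable def sigChar (μ : ℝ) : PowerSeries ℤ := PowerSeries.mk fun k => fsig μ k

/-- The sign of the level-`m` singular vector in the product of two Verma modules. -/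
noncomputable def pairSig (a b : ℝ) (m : ℕ) : ℤ := pairSign ⌈a⌉ ⌈b⌉ ⌈a + b⌉ m

theorem abs_pairSig_le (a b : ℝ) (m : ℕ) : |pairSig a b m| ≤ 1 := abs_pairSign_le _ _ _ _

theorem coeff_sigChar_mul (a b : ℝ) (K : ℕ) :
    PowerSeries.coeff K (sigChar a * sigChar b) =
      ∑ m ∈ Finset.range (K + 1), pairSig a b m * fsig (a + b - 2 * m) ((K : ℤ) - m) := by
  have hC : ⌈a + b⌉ = ⌈a⌉ + ⌈b⌉ ∨ ⌈a + b⌉ = ⌈a⌉ + ⌈b⌉ - 1 := by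
    have h1 := Int.ceil_add_le a b
    have h2 := Int.ceil_add_ceil_le a b
    omega
  rw [mul_comm, PowerSeries.coeff_mul,
    Finset.Nat.sum_antidiagonal_eq_sum_range_succ
      (fun i j => PowerSeries.coeff i (sigChar b) * PowerSeries.coeff j (sigChar a))]
  trans ∑ m ∈ Finset.range (K + 1), vermaSign ⌈b⌉ m * vermaSign ⌈a⌉ (K - m)
  · refine Finset.sum_congr rfl fun m hm => ?_
    simp only [sigChar, PowerSeries.coeff_mk, fsig_eq_vermaSign]
    rw [Nat.cast_sub (Nat.lt_succ_iff.1 (Finset.mem_range.1 hm))]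
  · rw [sum_vermaSign_mul _ _ _ hC]
    refine Finset.sum_congr rfl fun m _ => ?_
    rw [fsig_eq_vermaSign, pairSig]
    congr 2
    rw [show (2 : ℝ) * m = ((2 * m : ℤ) : ℝ) by push_cast; rfl, Int.ceil_sub_intCast]

/-- Signatures of the multiplicity spaces of the product with highest weights `a :: l`, computed by
merging the first two factors repeatedly. -/
noncomputable def multSig : ℝ → List ℝ → ℕ → ℤ
  | _, [], k => if k = 0 then 1 else 0
  | a, b :: l, k => ∑ m ∈ Finset.range (k + 1), pairSig a b m * multSig (a + b - 2 * m) l (k - m)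

theorem coeff_sigChar_mul_mul (a b : ℝ) (P : PowerSeries ℤ) (K : ℕ) :
    PowerSeries.coeff K (sigChar a * sigChar b * P) =
      ∑ m ∈ Finset.range (K + 1),
        pairSig a b m * PowerSeries.coeff (K - m) (sigChar (a + b - 2 * m) * P) := by
  let T : PowerSeries ℤ := ∑ m ∈ Finset.range (K + 1),
    PowerSeries.C (pairSig a b m) * (PowerSeries.X ^ m * sigChar (a + b - 2 * m))
  have hT (i : ℕ) (hi : i ≤ K) :
      PowerSeries.coeff i (sigChar a * sigChar b) = PowerSeries.coeff i T := by
    simp only [T, map_sum, PowerSeries.coeff_C_mul, PowerSeries.coeff_X_pow_mul', mul_ite, mul_zero]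
    rw [coeff_sigChar_mul, ← Finset.sum_filter]
    have : (Finset.range (K + 1)).filter (· ≤ i) = Finset.range (i + 1) := by
      ext m; simp; omega
    rw [this]
    refine Finset.sum_congr rfl fun m hm => ?_
    rw [sigChar, PowerSeries.coeff_mk, Nat.cast_sub (Nat.lt_succ_iff.1 (Finset.mem_range.1 hm))]
  have h : PowerSeries.coeff K (sigChar a * sigChar b * P) = PowerSeries.coeff K (T * P) := by
    rw [PowerSeries.coeff_mul, PowerSeries.coeff_mul]
    refine Finset.sum_congr rfl fun x hx => ?_
    rw [hT x.1 (by have := Finset.HasAntidiagonal.mem_antidiagonal.1 hx; omega)]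
  rw [h, Finset.sum_mul, map_sum]
  refine Finset.sum_congr rfl fun m hm => ?_
  rw [mul_assoc, mul_assoc, PowerSeries.coeff_C_mul, PowerSeries.coeff_X_pow_mul',
    if_pos (Nat.lt_succ_iff.1 (Finset.mem_range.1 hm))]

theorem coeff_prod_sigChar (l : List ℝ) (a : ℝ) (K : ℕ) :
    PowerSeries.coeff K ((a :: l).map sigChar).prod =
      ∑ m ∈ Finset.range (K + 1), multSig a l m * fsig ((a :: l).sum - 2 * m) ((K : ℤ) - m) := by
  induction l generalizing a K with
  | nil =>
    rw [Finset.sum_eq_single 0]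
    · simp [multSig, sigChar]
    · intro m _ hm; simp [multSig, hm]
    · simp
  | cons b l ih =>
    have e : ((a :: b :: l).map sigChar).prod = sigChar a * sigChar b * (l.map sigChar).prod := by
      simp [mul_assoc]
    rw [e, coeff_sigChar_mul_mul]
    simp only [multSig, Finset.sum_mul]
    let g (m r : ℕ) : ℤ := pairSig a b m * multSig (a + b - 2 * m) l r *
      fsig ((a :: b :: l).sum - 2 * (m + r : ℕ)) ((K : ℤ) - (m + r : ℕ))
    trans ∑ m ∈ Finset.range (K + 1), ∑ r ∈ Finset.range (K + 1 - m), g m r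
    · refine Finset.sum_congr rfl fun m hm => ?_
      have hm' : m ≤ K := Nat.lt_succ_iff.1 (Finset.mem_range.1 hm)
      have := ih (a + b - 2 * m) (K - m)
      rw [List.map_cons, List.prod_cons] at this
      rw [this, Finset.mul_sum, Nat.sub_add_comm hm']
      refine Finset.sum_congr rfl fun r _ => ?_
      simp only [g, List.sum_cons, ← mul_assoc]
      rw [Nat.cast_sub hm']
      congr 2
      · push_cast; ring
      · push_cast; ring
    · rw [← Finset.sum_range_diag_flip]
      refine Finset.sum_congr rfl fun s _ => Finset.sum_congr rfl fun m hm => ?_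
      have hm' : m ≤ s := Nat.lt_succ_iff.1 (Finset.mem_range.1 hm)
      simp only [g, Nat.add_sub_cancel' hm']

theorem fsig_zero (μ : ℝ) : fsig μ 0 = 1 := by
  rw [fsig_eq_vermaSign, vermaSign]; simp

theorem fsig_one (μ : ℝ) : fsig μ 1 = if 0 < μ then 1 else -1 := by
  rw [fsig_eq_vermaSign, vermaSign, if_neg (by norm_num)]
  have : 0 < ⌈μ⌉ ↔ 0 < μ := Int.ceil_pos
  split_ifs with h
  · have := this.2 h; omega
  · have := mt this.1 h; omega

theorem expansion_unique (μ : ℝ) (d d' : ℕ → ℤ)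
    (h : ∀ K : ℕ, ∑ m ∈ Finset.range (K + 1), d m * fsig (μ - 2 * m) ((K : ℤ) - m) =
      ∑ m ∈ Finset.range (K + 1), d' m * fsig (μ - 2 * m) ((K : ℤ) - m)) : d = d' := by
  funext k
  induction k using Nat.strong_induction_on with
  | _ k ih =>
    have hk := h k
    rw [Finset.sum_range_succ, Finset.sum_range_succ, sub_self, fsig_zero, mul_one, mul_one,
      Finset.sum_congr rfl fun m hm => by rw [ih m (Finset.mem_range.1 hm)]] at hk
    exact add_left_cancel hk

/-- `multSig` as a function of the whole list of highest weights. -/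
noncomputable def levelSig : List ℝ → ℕ → ℤ
  | [] => 0
  | a :: l => multSig a l

theorem coeff_prod_eq_levelSig (l : List ℝ) (hl : l ≠ []) (K : ℕ) :
    PowerSeries.coeff K (l.map sigChar).prod =
      ∑ m ∈ Finset.range (K + 1), levelSig l m * fsig (l.sum - 2 * m) ((K : ℤ) - m) := by
  cases l with
  | nil => exact absurd rfl hl
  | cons a l => exact coeff_prod_sigChar l a K

theorem levelSig_perm {l l' : List ℝ} (h : l.Perm l') : levelSig l = levelSig l' := by
  rcases eq_or_ne l [] with rfl | hl
  · rw [h.nil_eq]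
  refine expansion_unique l.sum _ _ fun K => ?_
  have hl' : l' ≠ [] := fun h' => hl (by simpa [h'] using h)
  rw [← coeff_prod_eq_levelSig l hl, h.sum_eq, ← coeff_prod_eq_levelSig l' hl',
    (h.map sigChar).prod_eq]

theorem sum_multichoose_sub (n k : ℕ) :
    ∑ m ∈ Finset.range (k + 1), Nat.multichoose n (k - m) = Nat.multichoose (n + 1) k := by
  have h := Finset.sum_range_reflect (fun m => Nat.multichoose n m) (k + 1)
  simp only [Nat.add_sub_cancel] at h
  rw [h]
  clear h
  induction k with
  | zero => simp
  | succ k ih => rw [Finset.sum_range_succ, ih, Nat.multichoose_succ_succ, add_comm]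

theorem abs_multSig_le (l : List ℝ) (a : ℝ) (k : ℕ) :
    |multSig a l k| ≤ Nat.multichoose l.length k := by
  induction l generalizing a k with
  | nil => cases k <;> simp [multSig]
  | cons b l ih =>
    rw [multSig, List.length_cons, ← sum_multichoose_sub, Nat.cast_sum]
    refine (Finset.abs_sum_le_sum_abs _ _).trans (Finset.sum_le_sum fun m _ => ?_)
    rw [abs_mul]
    exact (mul_le_of_le_one_left (abs_nonneg _) (abs_pairSig_le a b m)).trans (ih _ _)

/-- The level-`k` multiplicity space is definite. -/
def IsDefiniteAt (l : List ℝ) (k : ℕ) : Prop :=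
  |levelSig l k| = Nat.multichoose (l.length - 1) k

theorem IsDefiniteAt.perm {l l' : List ℝ} {k : ℕ} (h : IsDefiniteAt l k) (hl : l.Perm l') :
    IsDefiniteAt l' k := by
  rwa [IsDefiniteAt, ← levelSig_perm hl, ← hl.length_eq]

theorem IsDefiniteAt.merge {a b : ℝ} {l : List ℝ} {k : ℕ} (h : IsDefiniteAt (a :: b :: l) k)
    (m : ℕ) (hm : m ≤ k) : IsDefiniteAt ((a + b - 2 * m) :: l) (k - m) := by
  have hle (i : ℕ) : |pairSig a b i * multSig (a + b - 2 * i) l (k - i)| ≤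
      |multSig (a + b - 2 * i) l (k - i)| := by
    rw [abs_mul]
    exact mul_le_of_le_one_left (abs_nonneg _) (abs_pairSig_le a b i)
  have hle' (i : ℕ) : |pairSig a b i * multSig (a + b - 2 * i) l (k - i)| ≤
      Nat.multichoose l.length (k - i) := (hle i).trans (abs_multSig_le _ _ _)
  have hsum : ∑ i ∈ Finset.range (k + 1), |pairSig a b i * multSig (a + b - 2 * i) l (k - i)| =
      ∑ i ∈ Finset.range (k + 1), (Nat.multichoose l.length (k - i) : ℤ) := by
    refine le_antisymm (Finset.sum_le_sum fun i _ => hle' i) ?_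
    rw [← Nat.cast_sum, sum_multichoose_sub]
    refine h.symm.le.trans ?_
    rw [levelSig, multSig]
    exact Finset.abs_sum_le_sum_abs _ _
  have := (Finset.sum_eq_sum_iff_of_le fun i _ => hle' i).1 hsum m (Finset.mem_range.2 (by omega))
  exact le_antisymm (abs_multSig_le _ _ _) (this.symm.le.trans (hle m))

theorem levelSig_zero (l : List ℝ) (hl : l ≠ []) : levelSig l 0 = 1 := by
  have h := coeff_prod_eq_levelSig l hl 0
  have h1 (μ : ℝ) : PowerSeries.constantCoeff (sigChar μ) = 1 := by
    rw [← PowerSeries.coeff_zero_eq_constantCoeff_apply, sigChar, PowerSeries.coeff_mk]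
    exact fsig_zero μ
  rw [PowerSeries.coeff_zero_eq_constantCoeff_apply, map_list_prod, List.map_map] at h
  simpa [Function.comp_def, h1, fsig_zero] using h.symm

theorem levelSig_three_one (x y z : ℝ) :
    levelSig [x, y, z] 1 = fsig x 1 + fsig y 1 + fsig z 1 - fsig (x + y + z) 1 := by
  have h := coeff_prod_eq_levelSig [x, y, z] (by simp) 1
  rw [Finset.sum_range_succ, Finset.sum_range_one, levelSig_zero _ (by simp)] at h
  have hs : x + (y + z) = x + y + z := by ring
  simp [PowerSeries.coeff_mul, Finset.Nat.antidiagonal_succ, sigChar, fsig_zero, hs] at h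
  linarith

theorem not_isDefiniteAt_four {a b c d : ℝ} (ha : 0 < a) (hb : 0 < b) (hc : c < 0) (hd : d < 0)
    {k : ℕ} (hk : 1 ≤ k) : ¬ IsDefiniteAt [a, b, c, d] k := by
  intro h
  obtain ⟨k, rfl⟩ := Nat.exists_eq_add_of_le' hk
  have key (x y z w : ℝ) (hp : [a, b, c, d].Perm [x, y, z, w]) :
      |fsig (x + y - 2 * k) 1 + fsig z 1 + fsig w 1 - fsig (a + b + c + d - 2 * k) 1| = 2 := by
    have hs : x + y - 2 * k + z + w = a + b + c + d - 2 * k := by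
      have := hp.sum_eq
      simp only [List.sum_cons, List.sum_nil] at this
      linarith
    have := (h.perm hp).merge k (by omega)
    rw [Nat.add_sub_cancel_left, IsDefiniteAt, levelSig_three_one, hs] at this
    simpa using this
  have h1 := key c d a b (List.perm_append_comm (l₁ := [a, b]) (l₂ := [c, d]))
  have h2 := key a b c d (List.Perm.refl _)
  have h3 := key a c b d ((List.Perm.swap c b [d]).cons a)
  have hk0 : (0 : ℝ) ≤ k := k.cast_nonneg
  simp only [fsig_one, if_pos ha, if_pos hb, if_neg hc.not_gt, if_neg hd.not_gt] at h1 h2 h3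
  rw [if_neg (by linarith)] at h1
  split_ifs at h1 h2 h3 <;>
    first
    | (norm_num at h1; done)
    | (norm_num at h2; done)
    | (norm_num at h3; done)
    | linarith

theorem not_isDefiniteAt {P Q : List ℝ} (hP : ∀ x ∈ P, 0 < x) (hQ : ∀ x ∈ Q, x < 0)
    (hP2 : 2 ≤ P.length) (hQ2 : 2 ≤ Q.length) {k : ℕ} (hk : 1 ≤ k) : ¬ IsDefiniteAt (P ++ Q) k := by
  intro h
  induction hn : P.length + Q.length using Nat.strong_induction_on generalizing P Q with
  | _ n ih =>
    match P, Q with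
    | a :: b :: x :: P, Q =>
      refine ih (n - 1) (by simp at hn; omega) (P := (a + b) :: x :: P) (Q := Q) ?_ hQ (by simp) hQ2
        ?_ (by simp at hn ⊢; omega)
      · simp only [List.mem_cons, forall_eq_or_imp] at hP ⊢
        exact ⟨add_pos hP.1 hP.2.1, hP.2.2⟩
      · simpa using h.merge 0 (by omega)
    | [a, b], c :: d :: x :: Q =>
      refine ih (n - 1) (by simp at hn; omega) (P := [a, b]) (Q := (c + d) :: x :: Q) hP ?_ hP2
        (by simp) ?_ (by simp at hn ⊢; omega)
      · simp only [List.mem_cons, forall_eq_or_imp] at hQ ⊢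
        exact ⟨add_neg hQ.1 hQ.2.1, hQ.2.2⟩
      · have := (h.perm List.perm_append_comm).merge 0 (by omega)
        refine IsDefiniteAt.perm ?_ (List.perm_append_comm (l₁ := (c + d) :: x :: Q))
        simpa using this
    | [a, b], [c, d] =>
      simp at hP hQ
      exact not_isDefiniteAt_four hP.1 hP.2 hQ.1 hQ.2 hk h
    | [], _ => simp at hP2
    | [_], _ => simp at hP2
    | _, [] => simp at hQ2
    | _, [_] => simp at hQ2

theorem convSig_eq_coeff (n : ℕ) (lam : Fin n → ℝ) (k : ℕ) :
    convSig n lam k = PowerSeries.coeff k ((List.ofFn lam).map sigChar).prod := by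
  rw [List.map_ofFn, List.prod_ofFn, PowerSeries.coeff_prod, convSig,
    ← Finset.piAntidiag_univ_fin_eq_antidiagonalTuple]
  symm
  refine Finset.sum_bij (fun f _ => ⇑f) ?_ ?_ ?_ ?_
  · intro f hf; simpa [Finset.mem_finsuppAntidiag] using hf
  · intro f _ g _ hfg; exact DFunLike.coe_injective hfg
  · intro f hf
    exact ⟨Finsupp.equivFunOnFinite.symm f, by simpa [Finset.mem_finsuppAntidiag] using hf, rfl⟩
  · intro f _; simp [sigChar]

/-- Case 4 of Theorem 1.1: `2 ≤ p ≤ n−2` positive highest weights.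
The only definite multiplicity space is the level-0 space, which is positive definite. -/
theorem stmt_16 (n p : ℕ) (hn : 4 ≤ n) (hp2 : 2 ≤ p) (hpn : p ≤ n - 2)
    (lam : Fin n → ℝ) (hanti : Antitone lam)
    (hpos : ∀ i : Fin n, (i : ℕ) < p → 0 < lam i)
    (hneg : ∀ i : Fin n, p ≤ (i : ℕ) → lam i < 0)
    (hgen : ∀ (i : Fin n) (z : ℕ), lam i ≠ z)
    (hsumZ : ∀ z : ℕ, (∑ i, lam i) ≠ z)
    (d : ℕ → ℤ)
    (hd : ∀ k : ℕ, d k = convSig n lam k -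
      ∑ m ∈ Finset.range k, d m * fsig ((∑ i, lam i) - 2 * m) ((k : ℤ) - m)) :
    d 0 = 1 ∧ ∀ k : ℕ, 1 ≤ k → |d k| < ((k + n - 2).choose (n - 2) : ℤ) := by
  have hlen : (List.ofFn lam).length = n := List.length_ofFn
  have hne : List.ofFn lam ≠ [] := List.ne_nil_of_length_pos (by omega)
  have hdl : d = levelSig (List.ofFn lam) := by
    refine expansion_unique (∑ i, lam i) _ _ fun K => ?_
    have h := coeff_prod_eq_levelSig _ hne K
    rw [List.sum_ofFn] at h
    rw [← h, ← convSig_eq_coeff, Finset.sum_range_succ, sub_self, fsig_zero, hd K]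
    ring
  rw [hdl]
  refine ⟨levelSig_zero _ hne, fun k hk => ?_⟩
  have hmc : Nat.multichoose ((List.ofFn lam).length - 1) k = (k + n - 2).choose (n - 2) := by
    rw [hlen, Nat.multichoose_eq, show n - 1 + k - 1 = k + (n - 2) by omega, Nat.choose_symm_add,
      show k + n - 2 = k + (n - 2) by omega]
  rw [← hmc]
  refine lt_of_le_of_ne ?_ fun h => ?_
  · obtain ⟨a, l, hl⟩ := List.exists_cons_of_ne_nil hne
    rw [hl]
    exact abs_multSig_le l a k
  · refine not_isDefiniteAt (P := (List.ofFn lam).take p) (Q := (List.ofFn lam).drop p) ?_ ?_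
      (by rw [List.length_take, hlen]; omega) (by rw [List.length_drop, hlen]; omega) hk ?_
    · intro x hx
      obtain ⟨i, hi, rfl⟩ := List.mem_take_iff_getElem.1 hx
      rw [List.getElem_ofFn]
      exact hpos _ (by simp at hi ⊢; omega)
    · intro x hx
      obtain ⟨i, hi, rfl⟩ := List.mem_drop_iff_getElem.1 hx
      rw [List.getElem_ofFn]
      exact hneg _ (by simp)
    · rw [List.take_append_drop]
      exact h
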